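/- Let R be a unital ring with involution, J(R) its Jacobson radical, a ∈ R dual core invertible with dual core inverse a_co, and j ∈ J(R) (so that 1 + a_co j is invertible). Then a + j is dual core invertible if and only if (1 − a a_co) j (1 + a_co j)⁻¹ (1 − a_co a) = 0; and in this case, setting ρ = (1 + a_co j)⁻¹ a_co a (1 + a_co j)(1 − a a_co)(1 + j a_co)⁻¹ and ξ = (1 + a_co j)⁻¹ (1 − a_co a) j* (a_co)* (1 + j* (a_co)*)⁻¹, the elements 1 − ρ and 1 − ξ are invertible and (a + j)_co = (1 − ξ)⁻¹ (1 + a_co j)⁻¹ a_co (1 − ρ)⁻¹. -/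

import Mathlib

/-- `x` is the dual core inverse of `a`. -/
def IsDualCoreInverse {R : Type*} [Ring R] [StarRing R] (a x : R) : Prop :=
  a * x * a = a ∧ x * a * x = x ∧ star (x * a) = x * a ∧ x * x * a = x ∧ a * a * x = a

theorem isUnit_one_add_of_mem_jacobson_bot {R : Type*} [Ring R] {c : R}
    (hc : c ∈ Ideal.jacobson (⊥ : Ideal R)) : IsUnit (1 + c) := by
  have left_inv : ∀ d ∈ Ideal.jacobson (⊥ : Ideal R), ∃ z, z * (1 + d) = 1 := fun d hd ↦ by
    obtain ⟨z, hz⟩ := Ideal.mem_jacobson_iff.1 hd 1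
    rw [Ideal.mem_bot] at hz
    exact ⟨z, by linear_combination (norm := noncomm_ring) hz⟩
  obtain ⟨z, hz⟩ := left_inv c hc
  obtain ⟨w, hw⟩ := left_inv (-(z * c)) (neg_mem (Ideal.mul_mem_left _ _ hc))
  have hwz : w * z = 1 := by
    linear_combination (norm := noncomm_ring) hw + w * hz
  have hw' : w = 1 + c := by
    linear_combination (norm := noncomm_ring) hwz * (1 + c) - w * hz
  exact ⟨⟨1 + c, z, hw' ▸ hwz, hz⟩, rfl⟩

theorem isUnit_one_sub_of_mem_jacobson_bot {R : Type*} [Ring R] {c : R}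
    (hc : c ∈ Ideal.jacobson (⊥ : Ideal R)) : IsUnit (1 - c) := by
  simpa [sub_eq_add_neg] using isUnit_one_add_of_mem_jacobson_bot (neg_mem hc)

/-- If `b` is regular and `y` is an outer inverse of `b` for which `b - b * y * b` lies in the
Jacobson radical, then `y` is also an inner inverse of `b`. -/
theorem sub_mul_mul_eq_zero_of_mem_jacobson_bot {R : Type*} [Ring R] {b y z : R}
    (hb : b * z * b = b) (hy : y * b * y = y)
    (h : b - b * y * b ∈ Ideal.jacobson (⊥ : Ideal R)) : b - b * y * b = 0 := by
  set e := b - b * y * b with he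
  have heze : e * z * e = e := by
    have hq : (1 - b * y) * b = e := by rw [he]; noncomm_ring
    have hp : b * (1 - y * b) = e := by rw [he]; noncomm_ring
    have hqe : (1 - b * y) * e = e := by
      rw [he]
      linear_combination (norm := noncomm_ring) b * hy * b
    calc e * z * e = (1 - b * y) * (b * z * b) * (1 - y * b) := by
          nth_rw 1 [← hq]; rw [← hp]; noncomm_ring
      _ = e := by rw [hb, mul_assoc, hp, hqe]
  obtain ⟨u, hu⟩ := isUnit_one_sub_of_mem_jacobson_bot (Ideal.mul_mem_left _ z h)
  refine u.isUnit.mul_left_eq_zero.1 ?_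
  rw [hu, mul_sub, mul_one, ← mul_assoc, heze, sub_self]

/-- The dual core inverse of `b` obtained from a reflexive inverse `y` of `b`. -/
theorem isDualCoreInverse_of_reflexive {R : Type*} [Ring R] [StarRing R] {b y p q r s w : R}
    (hb : b * y * b = b) (hy : y * b * y = y) (hp : p = y * b) (hq : q = b * y)
    (hr : r * (1 - p * (1 - q)) = 1) (hr' : (1 - p * (1 - q)) * r = 1)
    (hs : s * (1 - (1 - p) * star p) = 1) (hs' : (1 - (1 - p) * star p) * s = 1)
    (hw : w * (1 - q * (1 - p)) = 1) :
    IsDualCoreInverse b (s * y * r) := by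
  have hbp : b * p = b := by rw [hp, ← mul_assoc, hb]
  have hqb : q * b = b := by rw [hq, hb]
  have hpy : p * y = y := by rw [hp, hy]
  have hyq : y * q = y := by rw [hq, ← mul_assoc, hy]
  have hpp : p * p = p := by rw [hp]; linear_combination (norm := noncomm_ring) hy * b
  have hqq : q * q = q := by rw [hq]; linear_combination (norm := noncomm_ring) b * hy
  have hps : p * s = p := by
    linear_combination (norm := noncomm_ring) p * hs' - hpp * star p * s
  have hrq : r * q = q := by
    linear_combination (norm := noncomm_ring) hr * q - r * p * hqq
  have hbs : b * s = b := by rw [← hbp, mul_assoc, hps]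
  have hrb : r * b = b := by rw [← hqb, ← mul_assoc, hrq]
  have hbz : b * (s * y * r) = q * r := by rw [← mul_assoc, ← mul_assoc, hbs, hq]
  have hzb : s * y * r * b = s * p := by rw [mul_assoc, hrb, mul_assoc, hp]
  have hqr : q * r = w * q * p := by
    have hqw : q = w * q * p * q := by
      linear_combination (norm := noncomm_ring) -hw * q - w * hqq
    have hpqr : p * q * r = p := by
      linear_combination (norm := noncomm_ring) p * hr' + hpp * r - hpp * q * r
    linear_combination (norm := noncomm_ring) hqw * r + w * q * hpqr
  have hstar : star (s * p) = s * p := by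
    have ht : (1 - p * (1 - star p)) * star s = 1 := by
      simpa using congrArg star hs
    have hpp' : star p * star p = star p := by
      simpa using congrArg star hpp
    rw [star_mul]
    linear_combination (norm := noncomm_ring) s * p * ht -
      s * (hpp * star p - hpp + hpp' - p * hpp') * star s - hs * star p * star s
  refine ⟨?_, ?_, ?_, ?_, ?_⟩
  · rw [hbz, mul_assoc, hrb, hqb]
  · rw [hzb, mul_assoc s p, ← mul_assoc p, ← mul_assoc p, hps, hpy, mul_assoc]
  · rw [hzb, hstar]
  · have hyr : y * r = y * w * q * p := by
      nth_rw 1 [← hyq]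
      linear_combination (norm := noncomm_ring) y * hqr
    have hyrs : y * r * s * p = y * r := by
      rw [hyr, mul_assoc _ p s, hps, mul_assoc _ p p, hpp]
    rw [mul_assoc, hzb]
    linear_combination (norm := noncomm_ring) s * hyrs
  · rw [mul_assoc, hbz]
    linear_combination (norm := noncomm_ring) b * hr' + hbp * r - hbp * q * r

/-- for `a` dual core invertible and `j` in the Jacobson radical,
`a + j` is dual core invertible iff `(1 - a a_co) j (1 + a_co j)⁻¹ (1 - a_co a) = 0`;
and in this case `1 - ρ`, `1 - ξ` are invertible and
`(a + j)_co = (1 - ξ)⁻¹ (1 + a_co j)⁻¹ a_co (1 - ρ)⁻¹`. -/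
theorem radical_perturbation_dual_core {R : Type*} [Ring R] [StarRing R]
    (a aco j : R)
    (ha : IsDualCoreInverse a aco)
    (hj : j ∈ Ideal.jacobson (⊥ : Ideal R))
    (ρ ξ : R)
    (hρ : ρ = Ring.inverse (1 + aco * j) * (aco * a) * (1 + aco * j) * (1 - a * aco) *
        Ring.inverse (1 + j * aco))
    (hξ : ξ = Ring.inverse (1 + aco * j) * (1 - aco * a) * (star j * star aco) *
        Ring.inverse (1 + star j * star aco)) :
    ((∃ x, IsDualCoreInverse (a + j) x) ↔
      (1 - a * aco) * j * Ring.inverse (1 + aco * j) * (1 - aco * a) = 0) ∧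
    ((1 - a * aco) * j * Ring.inverse (1 + aco * j) * (1 - aco * a) = 0 →
      IsUnit (1 - ρ) ∧ IsUnit (1 - ξ) ∧
      IsDualCoreInverse (a + j)
        (Ring.inverse (1 - ξ) * Ring.inverse (1 + aco * j) * aco * Ring.inverse (1 - ρ))) := by
  obtain ⟨hax, hxa, hstar, hxxa, haax⟩ := ha
  set x := aco
  set J := Ideal.jacobson (⊥ : Ideal R)
  have hu : IsUnit (1 + x * j) := isUnit_one_add_of_mem_jacobson_bot (Ideal.mul_mem_left _ _ hj)
  have hv : IsUnit (1 + j * x) := isUnit_one_add_of_mem_jacobson_bot (Ideal.mul_mem_right _ _ hj)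
  have hui := Ring.inverse_mul_cancel _ hu
  have hiu := Ring.mul_inverse_cancel _ hu
  have hiv := Ring.mul_inverse_cancel _ hv
  have hU : (1 + star j * star x) * star (Ring.inverse (1 + x * j)) = 1 := by
    simpa using congrArg star hui
  have hUinv : Ring.inverse (1 + star j * star x) = star (Ring.inverse (1 + x * j)) := by
    simp [← Ring.inverse_star]
  rw [hUinv] at hξ
  set u := Ring.inverse (1 + x * j)
  set v := Ring.inverse (1 + j * x)
  set p := u * x * (a + j) with hp
  set q := (a + j) * (u * x) with hq
  have hxv : u * x = x * v := by
    linear_combination (norm := noncomm_ring) hui * x * v - u * x * hiv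
  have hxau : (1 - x * a) * u = 1 - x * a := by
    linear_combination (norm := noncomm_ring) (1 - x * a) * hiu + hxa * j * u
  have hp' : 1 - p = u * (1 - x * a) := by
    rw [hp]; linear_combination (norm := noncomm_ring) -hui
  have hq' : 1 - q = (1 - a * x) * v := by
    rw [hq, hxv]; linear_combination (norm := noncomm_ring) -hiv
  have hyby : u * x * (a + j) * (u * x) = u * x := by
    linear_combination (norm := noncomm_ring)
      u * x * (a + j) * hxv + u * hxa * v + u * x * hiv
  have hE : (1 - a * x) * j * u * (1 - x * a) = (a + j) - (a + j) * (u * x) * (a + j) := by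
    have hxb : x * (a + j) * u * (1 - x * a) = 0 := by
      linear_combination (norm := noncomm_ring)
        hiu * (1 - x * a) - hxau * (1 - x * a) - hxa * a
    rw [hp] at hp'
    linear_combination (norm := noncomm_ring)
      hax * u * (1 - x * a) - a * hxb - (a + j) * hp'
  have hEJ : (1 - a * x) * j * u * (1 - x * a) ∈ J :=
    Ideal.mul_mem_right _ _ (Ideal.mul_mem_right _ _ (Ideal.mul_mem_left _ _ hj))
  have hρ' : ρ = p * (1 - q) := by
    rw [hρ, hq', hp]
    linear_combination (norm := noncomm_ring) u * hxa * j * (1 - a * x) * v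
  have hsp : 1 - star p = (1 - x * a) * star u := by
    have h := congrArg star hp'
    rwa [star_mul, star_sub, star_sub, star_one, hstar] at h
  have hξ' : ξ = (1 - p) * star p := by
    rw [hξ]
    linear_combination (norm := noncomm_ring)
      u * (1 - x * a) * hU - hp' * star p + u * (1 - x * a) * hsp + u * hxa * a * star u
  have hρJ : p * (1 - q) ∈ J := by
    have h : p * (1 - q) = u * x * (j * ((1 - a * x) * v)) := by
      rw [hq', hp]
      linear_combination (norm := noncomm_ring) -(u * x * haax * v)
    rw [h]
    exact Ideal.mul_mem_left _ _ (Ideal.mul_mem_right _ _ hj)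
  have hξJ : p * (1 - star p) ∈ J := by
    have h : p * (1 - star p) = u * x * (j * ((1 - x * a) * star u)) := by
      rw [hsp, hp]
      linear_combination (norm := noncomm_ring) -(u * hxa * a * star u)
    rw [h]
    exact Ideal.mul_mem_left _ _ (Ideal.mul_mem_right _ _ hj)
  have hqpJ : q * (1 - p) ∈ J := by
    have h : q * (1 - p) = -((a + j) * u * x * x) * (j * (u * (1 - x * a))) := by
      rw [hp', hq]
      linear_combination (norm := noncomm_ring)
        (a + j) * u * x * hiu * (1 - x * a) - (a + j) * u * hxxa
    rw [h]
    exact Ideal.mul_mem_left _ _ (Ideal.mul_mem_right _ _ hj)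
  have hρu : IsUnit (1 - ρ) := hρ' ▸ isUnit_one_sub_of_mem_jacobson_bot hρJ
  have hξu : IsUnit (1 - ξ) := by
    rw [hξ', ← isUnit_star]
    simpa using isUnit_one_sub_of_mem_jacobson_bot hξJ
  have hwu : IsUnit (1 - q * (1 - p)) := isUnit_one_sub_of_mem_jacobson_bot hqpJ
  have key (h : (1 - a * x) * j * u * (1 - x * a) = 0) :
      IsDualCoreInverse (a + j) (Ring.inverse (1 - ξ) * u * x * Ring.inverse (1 - ρ)) := by
    rw [mul_assoc _ u x]
    refine isDualCoreInverse_of_reflexive (sub_eq_zero.1 (hE ▸ h)).symm hyby hp hq ?_ ?_ ?_ ?_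
      (Ring.inverse_mul_cancel _ hwu)
    · rw [← hρ']; exact Ring.inverse_mul_cancel _ hρu
    · rw [← hρ']; exact Ring.mul_inverse_cancel _ hρu
    · rw [← hξ']; exact Ring.inverse_mul_cancel _ hξu
    · rw [← hξ']; exact Ring.mul_inverse_cancel _ hξu
  refine ⟨⟨fun ⟨z, hz⟩ ↦ ?_, fun h ↦ ⟨_, key h⟩⟩, fun h ↦ ⟨hρu, hξu, key h⟩⟩
  rw [hE]
  exact sub_mul_mul_eq_zero_of_mem_jacobson_bot hz.1 hyby (hE ▸ hEJ)
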